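/- (Proposition 2.3.3.) Let f ∈ C_c^∞(GL₂(k); ω) with W^f(1) = 0 (1 the identity matrix). Then there exist a function f₀ ∈ C_c^∞(GL₂(k); ω) which is supported inside the big cell of GL₂(k) — that is, f₀(g) = 0 for every upper-triangular g ∈ GL₂(k) — and an integer κ₀, such that J_κ(n, f) = J_κ(n, f₀) for every admissible triple n = (x21, x31, x32) and every κ ≥ κ₀. -/

import Mathlib

open Matrix MeasureTheory

noncomputable section

variable (p : ℕ) [Fact p.Prime]

/-- The general element of the split Lie algebra of type `G₂`, realized as a `7 × 7` matrix. -/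
def Xmat (a b x01 x10 x11 x21 x31 x32 y01 y10 y11 y21 y31 y32 : ℚ_[p]) :
    Matrix (Fin 7) (Fin 7) ℚ_[p] :=
  !![a, x01, x32, 0, -x21, y10, 2*x11;
     y01, b, x31, x21, 0, -y11, 2*x10;
     y32, y31, -a-b, -y10, y11, 0, 2*y21;
     0, y21, -x10, -a, -y01, -y32, 2*y11;
     -y21, 0, x11, -x01, -b, -y31, 2*y10;
     x10, -x11, 0, -x32, -x31, a+b, 2*x21;
     y11, y10, x21, x11, x10, y21, 0]

/-- The exponential of a `7 × 7` matrix as a finite sum; for a nilpotent matrix this is the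
genuine exponential, since `A ^ 7 = 0`. -/
def mexp (A : Matrix (Fin 7) (Fin 7) ℚ_[p]) : Matrix (Fin 7) (Fin 7) ℚ_[p] :=
  ∑ i ∈ Finset.range 7, (Nat.factorial i : ℚ_[p])⁻¹ • A ^ i

/-- `Ē(y10, y11, y21, y31, y32)`: the exponential of the nilpotent element of `G₂` with lower
coordinates `y10, y11, y21, y31, y32` (and `y01 = 0`). -/
def Ebar (y10 y11 y21 y31 y32 : ℚ_[p]) : Matrix (Fin 7) (Fin 7) ℚ_[p] :=
  mexp p (Xmat p 0 0 0 0 0 0 0 0 0 y10 y11 y21 y31 y32)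

/-- The compact open subset `N̄_κ ⊂ N̄`: the set of `Ē(y10,y11,y21,y31,y32)` with
`v(y10) ≥ -κ²`, `v(y11) ≥ -κ`, `v(y21) ≥ -κ³`, `v(y31) ≥ -κ⁵`, `v(y32) ≥ -κ⁴`. -/
def NbarK (κ : ℕ) : Set (Matrix (Fin 7) (Fin 7) ℚ_[p]) :=
  {M | ∃ y10 y11 y21 y31 y32 : ℚ_[p],
    ‖y10‖ ≤ (p : ℝ)^(κ^2) ∧ ‖y11‖ ≤ (p : ℝ)^κ ∧ ‖y21‖ ≤ (p : ℝ)^(κ^3) ∧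
    ‖y31‖ ≤ (p : ℝ)^(κ^5) ∧ ‖y32‖ ≤ (p : ℝ)^(κ^4) ∧
    M = Ebar p y10 y11 y21 y31 y32}

/-- `φ_κ`, the characteristic function of `N̄_κ`, with values in `ℂ`. -/
def phiK (κ : ℕ) (M : Matrix (Fin 7) (Fin 7) ℚ_[p]) : ℂ :=
  letI := Classical.dec (M ∈ NbarK p κ)
  if M ∈ NbarK p κ then 1 else 0

/-- The embedding `GL₂ ↪ GL₇` realizing `GL₂` as the Levi subgroup `M ⊂ G₂`:
`A ↦ block-diag(A, (det A)⁻¹, ᵗA⁻¹, det A, 1)`. -/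
def iotaM (A : Matrix (Fin 2) (Fin 2) ℚ_[p]) : Matrix (Fin 7) (Fin 7) ℚ_[p] :=
  let a := A 0 0; let b := A 0 1; let c := A 1 0; let d := A 1 1
  let Δ := a*d - b*c
  !![a, b, 0, 0, 0, 0, 0;
     c, d, 0, 0, 0, 0, 0;
     0, 0, Δ⁻¹, 0, 0, 0, 0;
     0, 0, 0, Δ⁻¹*d, -(Δ⁻¹*c), 0, 0;
     0, 0, 0, -(Δ⁻¹*b), Δ⁻¹*a, 0, 0;
     0, 0, 0, 0, 0, Δ, 0;
     0, 0, 0, 0, 0, 0, 1]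

/-- The unipotent element `[[1, x], [0, 1]]` of `GL₂(ℚ_p)`. -/
def uu (x : ℚ_[p]) : GL (Fin 2) ℚ_[p] :=
  Matrix.GeneralLinearGroup.mkOfDetNeZero !![1, x; 0, 1] (by
    rw [Matrix.det_fin_two_of]; norm_num)

/-- The scalar (central) element `t·I₂` of `GL₂(ℚ_p)`, for `t ∈ ℚ_p^×`. -/
def scalGL (t : ℚ_[p]ˣ) : GL (Fin 2) ℚ_[p] :=
  Units.map (Matrix.scalar (Fin 2)).toMonoidHom t

/-- `f ∈ C_c^∞(GL₂(ℚ_p); ω)`: `f` is locally constant, transforms under the center by the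
character `ω`, and is compactly supported modulo the center. -/
def SmoothCptModZ (ω : ℚ_[p]ˣ → ℂ) (f : GL (Fin 2) ℚ_[p] → ℂ) : Prop :=
  IsLocallyConstant f ∧
  (∀ t : ℚ_[p]ˣ, ∀ g, f (scalGL p t * g) = ω t * f g) ∧
  ∃ C : Set (GL (Fin 2) ℚ_[p]), IsCompact C ∧
    ∀ g, f g ≠ 0 → ∃ t : ℚ_[p]ˣ, ∃ c ∈ C, g = scalGL p t * c

variable [MeasurableSpace ℚ_[p]]

/-- The Whittaker-type integral `W^f(m) = ∫_{U_M} f(x·m) ψ(x)⁻¹ dx`. -/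
def Wf (μ : Measure ℚ_[p]) (ψ : ℚ_[p] → ℂ) (f : GL (Fin 2) ℚ_[p] → ℂ)
    (m : GL (Fin 2) ℚ_[p]) : ℂ :=
  ∫ x, f (uu p x * m) * (ψ x)⁻¹ ∂μ

/-- `(x21, x31, x32)` is *admissible* if `x21 ≠ 0`, `x32 ≠ 0`, `D = x21² + x32 ≠ 0` and,
for the resulting `y`-coordinates, the Levi component `m = [[a,b],[c,d]]` has `c ≠ 0` and
`ad - bc ≠ 0`. -/
def y10v (n : ℚ_[p] × ℚ_[p] × ℚ_[p]) : ℚ_[p] := -n.2.2 / (n.1^2 + n.2.2)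
def y11v (n : ℚ_[p] × ℚ_[p] × ℚ_[p]) : ℚ_[p] := (-n.2.1 + (1/2)*n.1) / (n.1^2 + n.2.2)
def y21v (n : ℚ_[p] × ℚ_[p] × ℚ_[p]) : ℚ_[p] := -n.1 / (n.1^2 + n.2.2)
def y31v (n : ℚ_[p] × ℚ_[p] × ℚ_[p]) : ℚ_[p] := ((1/2)*n.2.2*n.1) / (n.1^2 + n.2.2)^2
def y32v (n : ℚ_[p] × ℚ_[p] × ℚ_[p]) : ℚ_[p] :=
  ((3/4)*n.1^2 + n.2.2 + (1/2)*n.1*n.2.1) / (n.1^2 + n.2.2)^2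
def av (n : ℚ_[p] × ℚ_[p] × ℚ_[p]) : ℚ_[p] := y10v p n * y11v p n + y21v p n
def bv (n : ℚ_[p] × ℚ_[p] × ℚ_[p]) : ℚ_[p] := (y10v p n)^2
def cv (n : ℚ_[p] × ℚ_[p] × ℚ_[p]) : ℚ_[p] :=
  -(y11v p n)^2 + (1/2)*y11v p n*y21v p n - y32v p n
def dv (n : ℚ_[p] × ℚ_[p] × ℚ_[p]) : ℚ_[p] :=
  -(1/2)*y10v p n*y11v p n + y21v p n - y31v p n

/-- Admissibility of a triple `(x21, x31, x32)`. -/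
def Adm (n : ℚ_[p] × ℚ_[p] × ℚ_[p]) : Prop :=
  n.1 ≠ 0 ∧ n.2.2 ≠ 0 ∧ n.1^2 + n.2.2 ≠ 0 ∧ cv p n ≠ 0 ∧
    av p n * dv p n - bv p n * cv p n ≠ 0

/-- The Levi component `m(n) = [[a,b],[c,d]] ∈ GL₂(ℚ_p)` of an admissible triple. -/
def mGL (n : ℚ_[p] × ℚ_[p] × ℚ_[p]) (h : Adm p n) : GL (Fin 2) ℚ_[p] :=
  Matrix.GeneralLinearGroup.mkOfDetNeZero !![av p n, bv p n; cv p n, dv p n] (by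
    rw [Matrix.det_fin_two_of]; exact h.2.2.2.2)

/-- `n̄(n) ∈ GL₇(ℚ_p)`, the opposite-unipotent component of the decomposition
`ẇ₀⁻¹·E(1,0,x21,x31,x32) = m(n)·n'·n̄(n)`. -/
def nbarM (n : ℚ_[p] × ℚ_[p] × ℚ_[p]) : Matrix (Fin 7) (Fin 7) ℚ_[p] :=
  Ebar p (y10v p n) (y11v p n) (y21v p n) (y31v p n) (y32v p n)

/-- The partial Bessel function
`J_κ(n, f) = ∫_{U_M} W^f(m(n)·u) φ_κ(u·n̄(n)·u⁻¹) ψ(u)⁻¹ du`, the conjugation being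
computed in `GL₇(ℚ_p)` via the embedding `ι`. -/
def Jk (μ : Measure ℚ_[p]) (ψ : ℚ_[p] → ℂ) (κ : ℕ)
    (n : ℚ_[p] × ℚ_[p] × ℚ_[p]) (h : Adm p n) (f : GL (Fin 2) ℚ_[p] → ℂ) : ℂ :=
  ∫ x, Wf p μ ψ f (mGL p n h * uu p x) *
    phiK p κ (iotaM p (uu p x).val * nbarM p n * (iotaM p (uu p x).val)⁻¹) *
    (ψ x)⁻¹ ∂μ

end

section BesselBigCell

variable (p : ℕ) [Fact p.Prime]

theorem uu_val (x : ℚ_[p]) : (uu p x : Matrix (Fin 2) (Fin 2) ℚ_[p]) = !![1, x; 0, 1] := rfl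

theorem uu_add (x y : ℚ_[p]) : uu p (x + y) = uu p x * uu p y := by
  ext i j
  fin_cases i <;> fin_cases j <;> simp [uu_val, Matrix.mul_apply, Fin.sum_univ_two, add_comm]

theorem uu_zero : uu p 0 = 1 := by
  ext i j
  fin_cases i <;> fin_cases j <;> simp [uu_val]

theorem continuous_uu : Continuous (uu p) := by
  have h : ∀ x, (uu p x)⁻¹ = uu p (-x) := fun x ↦ by
    rw [inv_eq_iff_mul_eq_one, ← uu_add, add_neg_cancel, uu_zero]
  have hv : Continuous fun x ↦ (uu p x : Matrix (Fin 2) (Fin 2) ℚ_[p]) := by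
    simp only [uu_val]
    refine continuous_matrix fun i j ↦ ?_
    fin_cases i <;> fin_cases j <;> simp <;> fun_prop
  rw [Units.continuous_iff]
  refine ⟨hv, ?_⟩
  simp only [h]
  exact hv.comp continuous_neg

/-- The diagonal element `diag(1, d)` of `GL₂(ℚ_p)`. -/
noncomputable def diagGL (d : ℚ_[p]ˣ) : GL (Fin 2) ℚ_[p] :=
  Matrix.GeneralLinearGroup.mkOfDetNeZero !![1, 0; 0, (d : ℚ_[p])] (by
    rw [Matrix.det_fin_two_of]; simp)

theorem diagGL_val (d : ℚ_[p]ˣ) :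
    (diagGL p d : Matrix (Fin 2) (Fin 2) ℚ_[p]) = !![1, 0; 0, (d : ℚ_[p])] := rfl

theorem diagGL_mul (d e : ℚ_[p]ˣ) : diagGL p (d * e) = diagGL p d * diagGL p e := by
  ext i j
  fin_cases i <;> fin_cases j <;> simp [diagGL_val, Matrix.mul_apply, Fin.sum_univ_two]

theorem diagGL_one : diagGL p 1 = 1 := by
  ext i j
  fin_cases i <;> fin_cases j <;> simp [diagGL_val]

theorem continuous_diagGL : Continuous (diagGL p) := by
  have h : ∀ d, (diagGL p d)⁻¹ = diagGL p d⁻¹ := fun d ↦ by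
    rw [inv_eq_iff_mul_eq_one, ← diagGL_mul, mul_inv_cancel, diagGL_one]
  have hv : Continuous fun d ↦ (diagGL p d : Matrix (Fin 2) (Fin 2) ℚ_[p]) := by
    simp only [diagGL_val]
    refine continuous_matrix fun i j ↦ ?_
    fin_cases i <;> fin_cases j <;> simp <;>
      first | exact continuous_const | exact Units.continuous_val
  rw [Units.continuous_iff]
  refine ⟨hv, ?_⟩
  simp only [h]
  exact hv.comp continuous_inv

theorem scalGL_mul_apply (t : ℚ_[p]ˣ) (g : GL (Fin 2) ℚ_[p]) (i j : Fin 2) :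
    (scalGL p t * g : GL (Fin 2) ℚ_[p]) i j = t * g i j := by
  simp [scalGL]

theorem scalGL_comm (t : ℚ_[p]ˣ) (g : GL (Fin 2) ℚ_[p]) :
    g * scalGL p t = scalGL p t * g := by
  ext i j
  simp [scalGL, mul_comm]

variable {p}

/-- On the support of `f`, the matrix entries are controlled by the determinant. -/
theorem SmoothCptModZ.exists_bound {ω : ℚ_[p]ˣ → ℂ} {f : GL (Fin 2) ℚ_[p] → ℂ}
    (hf : SmoothCptModZ p ω f) :
    ∃ B : ℝ, 1 ≤ B ∧ ∀ g, f g ≠ 0 → ∀ i j, ‖g i j‖ ^ 2 ≤ B * ‖g.val.det‖ := by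
  obtain ⟨-, -, C, hC, hs⟩ := hf
  have hdet : ∀ g : GL (Fin 2) ℚ_[p], ‖g.val.det‖ ≠ 0 := fun g ↦
    norm_ne_zero_iff.2 (Matrix.GeneralLinearGroup.det_ne_zero g)
  have hcont : Continuous fun g : GL (Fin 2) ℚ_[p] ↦ (∑ i, ∑ j, ‖g i j‖ ^ 2) / ‖g.val.det‖ := by
    refine Continuous.div ?_ ?_ hdet
    · refine continuous_finsetSum _ fun i _ ↦ continuous_finsetSum _ fun j _ ↦ ?_
      exact ((Units.continuous_val.matrix_elem i j).norm).pow 2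
    · exact (Units.continuous_val.matrix_det).norm
  obtain ⟨B, hB⟩ := hC.bddAbove_image hcont.continuousOn
  refine ⟨max B 1, le_max_right _ _, fun g hg i j ↦ ?_⟩
  obtain ⟨t, c, hc, rfl⟩ := hs g hg
  have h1 := hB ⟨c, hc, rfl⟩
  have hpos : 0 < ‖c.val.det‖ := lt_of_le_of_ne (norm_nonneg _) (hdet c).symm
  simp only at h1
  rw [div_le_iff₀ hpos] at h1
  have h2 : ‖c i j‖ ^ 2 ≤ ∑ i, ∑ j, ‖c i j‖ ^ 2 :=
    (Finset.single_le_sum (f := fun j ↦ ‖c i j‖ ^ 2) (fun _ _ ↦ by positivity)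
      (Finset.mem_univ j)).trans
    (Finset.single_le_sum (f := fun i ↦ ∑ j, ‖c i j‖ ^ 2) (fun _ _ ↦ by positivity)
      (Finset.mem_univ i))
  have h3 : (scalGL p t * c).val.det = t ^ 2 * c.val.det := by
    simp [scalGL, Matrix.det_mul]
  rw [scalGL_mul_apply, h3, norm_mul, norm_mul, norm_pow, mul_pow]
  have h4 : ‖c i j‖ ^ 2 ≤ max B 1 * ‖c.val.det‖ :=
    h2.trans (h1.trans (mul_le_mul_of_nonneg_right (le_max_left _ _) hpos.le))
  calc _ ≤ ‖(t : ℚ_[p])‖ ^ 2 * (max B 1 * ‖c.val.det‖) := by gcongr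
    _ = _ := by ring

/-- Integrating a locally constant family over a compact set preserves local constancy. -/
theorem isLocallyConstant_setIntegral [MeasurableSpace ℚ_[p]] [BorelSpace ℚ_[p]] {X : Type*} [TopologicalSpace X]
    (μ : Measure ℚ_[p]) {K : Set ℚ_[p]} (hK : IsCompact K) {F : X → ℚ_[p] → ℂ}
    (hF : IsLocallyConstant fun q : X × ℚ_[p] ↦ F q.1 q.2) (w : ℚ_[p] → ℂ) :
    IsLocallyConstant fun x ↦ ∫ s in K, F x s * w s ∂μ := by
  rw [IsLocallyConstant.iff_eventually_eq] at hF ⊢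
  intro x
  have : ∀ᶠ x' in nhds x, ∀ s ∈ K, F x' s = F x s := by
    refine hK.eventually_forall_of_forall_eventually fun s _ ↦ ?_
    have h1 := hF (x, s)
    have h2 : ∀ᶠ s' in nhds s, F x s' = F x s :=
      (Continuous.tendsto (f := fun s' ↦ (x, s')) (by fun_prop) s).eventually h1
    have h3 : ∀ᶠ q : X × ℚ_[p] in nhds (x, s), F x q.2 = F x s :=
      (continuous_snd.tendsto (x, s)).eventually h2
    filter_upwards [h1, h3] with q hq hq'
    rw [hq, hq']
  filter_upwards [this] with x' hx'
  exact setIntegral_congr_fun hK.measurableSet fun s hs ↦ by simp only [hx' s hs]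

/-- Averaging `f` along a one-parameter family of homeomorphisms commuting with the center. -/
theorem SmoothCptModZ.average [MeasurableSpace ℚ_[p]] [BorelSpace ℚ_[p]] {ω : ℚ_[p]ˣ → ℂ} {f : GL (Fin 2) ℚ_[p] → ℂ}
    (hf : SmoothCptModZ p ω f) (μ : Measure ℚ_[p]) {K : Set ℚ_[p]} (hK : IsCompact K)
    (α β : ℚ_[p] → GL (Fin 2) ℚ_[p] → GL (Fin 2) ℚ_[p])
    (hα : Continuous fun q : GL (Fin 2) ℚ_[p] × ℚ_[p] ↦ α q.2 q.1)
    (hβ : Continuous fun q : GL (Fin 2) ℚ_[p] × ℚ_[p] ↦ β q.2 q.1)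
    (hβα : ∀ s g, β s (α s g) = g)
    (hαz : ∀ s t g, α s (scalGL p t * g) = scalGL p t * α s g)
    (hβz : ∀ s t g, β s (scalGL p t * g) = scalGL p t * β s g)
    (w : ℚ_[p] → ℂ) (c : ℂ) :
    SmoothCptModZ p ω fun g ↦ c * ∫ s in K, f (α s g) * w s ∂μ := by
  obtain ⟨h1, h2, C, hC, hs⟩ := hf
  refine ⟨?_, ?_, (fun q : GL (Fin 2) ℚ_[p] × ℚ_[p] ↦ β q.2 q.1) '' (C ×ˢ K),
    (hC.prod hK).image hβ, ?_⟩
  · exact (isLocallyConstant_setIntegral μ hK (F := fun g s ↦ f (α s g))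
      (h1.comp_continuous hα) w).comp (fun z ↦ c * z)
  · intro t g
    simp only [hαz, h2, mul_assoc]
    rw [integral_const_mul]
    ring
  · intro g hg
    have : ∃ s ∈ K, f (α s g) ≠ 0 := by
      by_contra! hcon
      apply hg
      have h0 : ∫ s in K, f (α s g) * w s ∂μ = 0 :=
        setIntegral_eq_zero_of_forall_eq_zero fun s hs ↦ by rw [hcon s hs, zero_mul]
      simp only [h0, mul_zero]
    obtain ⟨s, hsK, hfs⟩ := this
    obtain ⟨t, x, hx, hgx⟩ := hs _ hfs
    refine ⟨t, β s x, ⟨(x, s), ⟨hx, hsK⟩, rfl⟩, ?_⟩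
    rw [← hβz, ← hgx, hβα]

/-- The integral of a function agrees with the integral of its average over translates. -/
theorem integral_setIntegral_translate [MeasurableSpace ℚ_[p]] [BorelSpace ℚ_[p]] (μ : Measure ℚ_[p])
    [μ.IsAddHaarMeasure] {K : Set ℚ_[p]} (hK : IsCompact K) {H : ℚ_[p] → ℂ}
    (hH : Integrable H μ) :
    ∫ x, ∫ t in K, H (x + t) ∂μ ∂μ = μ.real K * ∫ x, H x ∂μ := by
  have : IsFiniteMeasure (μ.restrict K) := ⟨by simpa using hK.measure_lt_top⟩
  have hint : Integrable (fun q : ℚ_[p] × ℚ_[p] ↦ H (q.1 + q.2)) (μ.prod (μ.restrict K)) := by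
    have hm : MeasurePreserving (fun q : ℚ_[p] × ℚ_[p] ↦ (q.2, q.2 + q.1))
        (μ.prod (μ.restrict K)) ((μ.restrict K).prod μ) :=
      (measurePreserving_prod_add (μ.restrict K) μ).comp Measure.measurePreserving_swap
    have := hm.integrable_comp_of_integrable (hH.comp_snd (μ.restrict K))
    refine this.congr (.of_forall fun q ↦ ?_)
    simp [add_comm]
  rw [integral_integral_swap hint]
  simp [integral_add_right_eq_self, Measure.real]

theorem iotaM_uu (x : ℚ_[p]) : iotaM p (uu p x).val =
    !![1, x, 0, 0, 0, 0, 0;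
       0, 1, 0, 0, 0, 0, 0;
       0, 0, 1, 0, 0, 0, 0;
       0, 0, 0, 1, 0, 0, 0;
       0, 0, 0, -x, 1, 0, 0;
       0, 0, 0, 0, 0, 1, 0;
       0, 0, 0, 0, 0, 0, 1] := by
  simp [iotaM, uu_val]

theorem iotaM_uu_add (x y : ℚ_[p]) :
    iotaM p (uu p (x + y)).val = iotaM p (uu p x).val * iotaM p (uu p y).val := by
  simp only [iotaM_uu]
  ext i j
  fin_cases i <;> fin_cases j <;>
    simp [Matrix.mul_apply, Fin.sum_univ_succ, add_comm]

theorem iotaM_uu_zero : iotaM p (uu p 0).val = 1 := by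
  rw [iotaM_uu]
  ext i j
  fin_cases i <;> fin_cases j <;> simp

theorem iotaM_uu_inv (x : ℚ_[p]) :
    (iotaM p (uu p x).val)⁻¹ = iotaM p (uu p (-x)).val := by
  refine Matrix.inv_eq_right_inv ?_
  rw [← iotaM_uu_add, add_neg_cancel, iotaM_uu_zero]

theorem iotaM_uu_mul_Xmat (t y10 y11 y21 y31 y32 : ℚ_[p]) :
    iotaM p (uu p t).val * Xmat p 0 0 0 0 0 0 0 0 0 y10 y11 y21 y31 y32 =
      Xmat p 0 0 0 0 0 0 0 0 0 (y10 - t * y11) y11 y21 (y31 - t * y32) y32 *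
        iotaM p (uu p t).val := by
  simp only [iotaM_uu, Xmat]
  ext i j
  fin_cases i <;> fin_cases j <;>
    simp [Matrix.mul_apply, Fin.sum_univ_succ] <;> ring

theorem iotaM_uu_conj_Ebar (t y10 y11 y21 y31 y32 : ℚ_[p]) :
    iotaM p (uu p t).val * Ebar p y10 y11 y21 y31 y32 * (iotaM p (uu p t).val)⁻¹ =
      Ebar p (y10 - t * y11) y11 y21 (y31 - t * y32) y32 := by
  have h : SemiconjBy (iotaM p (uu p t).val) (Xmat p 0 0 0 0 0 0 0 0 0 y10 y11 y21 y31 y32)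
      (Xmat p 0 0 0 0 0 0 0 0 0 (y10 - t * y11) y11 y21 (y31 - t * y32) y32) :=
    iotaM_uu_mul_Xmat t y10 y11 y21 y31 y32
  have h' : iotaM p (uu p t).val * Ebar p y10 y11 y21 y31 y32 =
      Ebar p (y10 - t * y11) y11 y21 (y31 - t * y32) y32 * iotaM p (uu p t).val := by
    simp only [Ebar, mexp, Finset.mul_sum, Finset.sum_mul, mul_smul_comm, smul_mul_assoc]
    exact Finset.sum_congr rfl fun i _ ↦ by rw [(h.pow_right i).eq]
  rw [h', mul_assoc, iotaM_uu_inv, ← iotaM_uu_add, add_neg_cancel, iotaM_uu_zero, mul_one]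

theorem conj_mem_NbarK {κ : ℕ} (hκ : 2 ≤ κ) {t : ℚ_[p]} (ht : ‖t‖ ≤ (p : ℝ) ^ κ)
    {M : Matrix (Fin 7) (Fin 7) ℚ_[p]} (hM : M ∈ NbarK p κ) :
    iotaM p (uu p t).val * M * (iotaM p (uu p t).val)⁻¹ ∈ NbarK p κ := by
  obtain ⟨y10, y11, y21, y31, y32, h10, h11, h21, h31, h32, rfl⟩ := hM
  have hp : (1 : ℝ) ≤ p := by exact_mod_cast (Fact.out : p.Prime).one_lt.le
  have aux : ∀ {a b : ℚ_[p]} {k l : ℕ}, ‖a‖ ≤ (p : ℝ) ^ l → ‖b‖ ≤ (p : ℝ) ^ k → κ + k ≤ l →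
      ‖a - t * b‖ ≤ (p : ℝ) ^ l := by
    intro a b k l ha hb hkl
    rw [sub_eq_add_neg]
    refine (Padic.nonarchimedean _ _).trans (max_le ha ?_)
    calc ‖-(t * b)‖ ≤ (p : ℝ) ^ κ * (p : ℝ) ^ k := by rw [norm_neg, norm_mul]; gcongr
      _ = (p : ℝ) ^ (κ + k) := (pow_add _ _ _).symm
      _ ≤ _ := pow_le_pow_right₀ hp hkl
  have h4 : κ ≤ κ ^ 4 := Nat.le_self_pow (by norm_num) κ
  exact ⟨y10 - t * y11, y11, y21, y31 - t * y32, y32, aux h10 h11 (by nlinarith), h11, h21,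
    aux h31 h32 (by rw [pow_succ κ 4]; nlinarith), h32, iotaM_uu_conj_Ebar t _ _ _ _ _⟩

theorem phiK_conj_add {κ : ℕ} (hκ : 2 ≤ κ) (M : Matrix (Fin 7) (Fin 7) ℚ_[p]) (x : ℚ_[p])
    {t : ℚ_[p]} (ht : ‖t‖ ≤ (p : ℝ) ^ κ) :
    phiK p κ (iotaM p (uu p (x + t)).val * M * (iotaM p (uu p (x + t)).val)⁻¹) =
      phiK p κ (iotaM p (uu p x).val * M * (iotaM p (uu p x).val)⁻¹) := by
  have key : ∀ (x s : ℚ_[p]), ‖s‖ ≤ (p : ℝ) ^ κ →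
      iotaM p (uu p x).val * M * (iotaM p (uu p x).val)⁻¹ ∈ NbarK p κ →
      iotaM p (uu p (x + s)).val * M * (iotaM p (uu p (x + s)).val)⁻¹ ∈ NbarK p κ := by
    intro x s hs hx
    have := conj_mem_NbarK hκ hs hx
    rw [add_comm, iotaM_uu_add, Matrix.mul_inv_rev]
    simpa only [mul_assoc] using this
  have hiff : iotaM p (uu p (x + t)).val * M * (iotaM p (uu p (x + t)).val)⁻¹ ∈ NbarK p κ ↔
      iotaM p (uu p x).val * M * (iotaM p (uu p x).val)⁻¹ ∈ NbarK p κ := by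
    refine ⟨fun h ↦ ?_, key x t ht⟩
    have := key (x + t) (-t) (by rwa [norm_neg]) h
    rwa [add_neg_cancel_right] at this
  unfold phiK
  by_cases h : iotaM p (uu p x).val * M * (iotaM p (uu p x).val)⁻¹ ∈ NbarK p κ
  · rw [if_pos h, if_pos (hiff.2 h)]
  · rw [if_neg h, if_neg (mt hiff.1 h)]

theorem phiK_conj_isLocallyConstant {κ : ℕ} (hκ : 2 ≤ κ) (M : Matrix (Fin 7) (Fin 7) ℚ_[p]) :
    IsLocallyConstant fun x ↦
      phiK p κ (iotaM p (uu p x).val * M * (iotaM p (uu p x).val)⁻¹) := by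
  rw [IsLocallyConstant.iff_eventually_eq]
  intro x
  have hp : (0 : ℝ) < p := by exact_mod_cast (Fact.out : p.Prime).pos
  filter_upwards [Metric.closedBall_mem_nhds x (pow_pos hp κ)] with y hy
  have := phiK_conj_add hκ M x (t := y - x) (by rwa [mem_closedBall_iff_norm] at hy)
  rwa [add_sub_cancel] at this

theorem norm_le_of_norm_add_mul_sq_le {a c y : ℚ_[p]} {D : ℝ} (hc : c ≠ 0)
    (h : ‖a + y * c‖ ^ 2 ≤ D) : ‖y‖ ≤ (√D + ‖a‖) / ‖c‖ := by
  rw [le_div_iff₀ (norm_pos_iff.2 hc), ← norm_mul]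
  have h1 : ‖a + y * c‖ ≤ √D := Real.le_sqrt_of_sq_le h
  calc ‖y * c‖ = ‖(a + y * c) - a‖ := by ring_nf
    _ ≤ ‖a + y * c‖ + ‖a‖ := norm_sub_le _ _
    _ ≤ _ := by gcongr

theorem SmoothCptModZ.hasCompactSupport_two_sided {ω : ℚ_[p]ˣ → ℂ} {f : GL (Fin 2) ℚ_[p] → ℂ}
    (hf : SmoothCptModZ p ω f) {m : GL (Fin 2) ℚ_[p]} (hm : m 1 0 ≠ 0) :
    HasCompactSupport fun q : ℚ_[p] × ℚ_[p] ↦ f (uu p q.1 * m * uu p q.2) := by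
  obtain ⟨B, -, hB⟩ := hf.exists_bound
  refine HasCompactSupport.intro
    ((isCompact_closedBall (0 : ℚ_[p]) ((√(B * ‖m.val.det‖) + ‖m 0 0‖) / ‖m 1 0‖)).prod
      (isCompact_closedBall (0 : ℚ_[p]) ((√(B * ‖m.val.det‖) + ‖m 1 1‖) / ‖m 1 0‖))) ?_
  intro q hq
  by_contra hne
  refine hq ?_
  have hdet : (uu p q.1 * m * uu p q.2).val.det = m.val.det := by
    rw [Units.val_mul, Units.val_mul, Matrix.det_mul, Matrix.det_mul, uu_val, uu_val]
    simp
  have h := hB _ hne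
  rw [hdet] at h
  have h0 := h 0 0
  have h1 := h 1 1
  simp only [Units.val_mul, uu_val, Matrix.mul_apply, Fin.sum_univ_two] at h0 h1
  simp at h0 h1
  simp only [Set.mem_prod, mem_closedBall_zero_iff]
  exact ⟨norm_le_of_norm_add_mul_sq_le hm h0,
    norm_le_of_norm_add_mul_sq_le hm (by rwa [add_comm, mul_comm])⟩

theorem uu_neg_mul_uu (s : ℚ_[p]) : uu p (-s) * uu p s = 1 := by
  rw [← uu_add, neg_add_cancel, uu_zero]

theorem uu_mul_uu_neg (s : ℚ_[p]) : uu p s * uu p (-s) = 1 := by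
  rw [← uu_add, add_neg_cancel, uu_zero]

section Integrals

variable [MeasurableSpace ℚ_[p]] [BorelSpace ℚ_[p]] {μ : Measure ℚ_[p]} {ψ : ℚ_[p] → ℂ}
  {ω : ℚ_[p]ˣ → ℂ} {f : GL (Fin 2) ℚ_[p] → ℂ}

variable (μ ψ) in
/-- The `(K, ψ)`-average of `f` under left translation by the unipotent radical. -/
noncomputable def leftAverage (K : Set ℚ_[p]) (f : GL (Fin 2) ℚ_[p] → ℂ)
    (g : GL (Fin 2) ℚ_[p]) : ℂ :=
  (μ.real K : ℂ)⁻¹ * ∫ s in K, f (uu p s * g) * (ψ s)⁻¹ ∂μ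

variable (μ ψ) in
/-- The `(K, ψ)`-average of `f` under right translation by the unipotent radical. -/
noncomputable def rightAverage (K : Set ℚ_[p]) (f : GL (Fin 2) ℚ_[p] → ℂ)
    (g : GL (Fin 2) ℚ_[p]) : ℂ :=
  (μ.real K : ℂ)⁻¹ * ∫ s in K, f (g * uu p s) * (ψ s)⁻¹ ∂μ

theorem SmoothCptModZ.average_left (hf : SmoothCptModZ p ω f) {K : Set ℚ_[p]}
    (hK : IsCompact K) : SmoothCptModZ p ω (leftAverage μ ψ K f) := by
  have hu := (continuous_uu p).comp (continuous_snd (X := GL (Fin 2) ℚ_[p]))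
  have hu' := (continuous_uu p).comp (continuous_snd (X := GL (Fin 2) ℚ_[p])).neg
  refine hf.average μ hK (fun s g ↦ uu p s * g) (fun s g ↦ uu p (-s) * g)
    (hu.mul continuous_fst) (hu'.mul continuous_fst) ?_ ?_ ?_ _ _
  · intro s g
    rw [← mul_assoc, uu_neg_mul_uu, one_mul]
  · intro s t g
    rw [← mul_assoc, scalGL_comm, mul_assoc]
  · intro s t g
    rw [← mul_assoc, scalGL_comm, mul_assoc]

theorem SmoothCptModZ.average_right (hf : SmoothCptModZ p ω f) {K : Set ℚ_[p]}
    (hK : IsCompact K) : SmoothCptModZ p ω (rightAverage μ ψ K f) := by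
  have hu := (continuous_uu p).comp (continuous_snd (X := GL (Fin 2) ℚ_[p]))
  have hu' := (continuous_uu p).comp (continuous_snd (X := GL (Fin 2) ℚ_[p])).neg
  refine hf.average μ hK (fun s g ↦ g * uu p s) (fun s g ↦ g * uu p (-s))
    (continuous_fst.mul hu) (continuous_fst.mul hu') ?_ ?_ ?_ _ _
  · intro s g
    rw [mul_assoc, uu_mul_uu_neg, mul_one]
  · intro s t g
    rw [mul_assoc]
  · intro s t g
    rw [mul_assoc]

variable [μ.IsAddHaarMeasure]

theorem SmoothCptModZ.integrable_two_sided (hf : SmoothCptModZ p ω f) {m : GL (Fin 2) ℚ_[p]}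
    (hm : m 1 0 ≠ 0) {w : ℚ_[p] × ℚ_[p] → ℂ} (hw : Continuous w) :
    Integrable (fun q : ℚ_[p] × ℚ_[p] ↦ f (uu p q.1 * m * uu p q.2) * w q) (μ.prod μ) := by
  refine Continuous.integrable_of_hasCompactSupport ?_
    ((hf.hasCompactSupport_two_sided hm).mul_right)
  refine Continuous.mul (hf.1.continuous.comp ?_) hw
  exact (((continuous_uu p).comp continuous_fst).mul continuous_const).mul
    ((continuous_uu p).comp continuous_snd)

theorem SmoothCptModZ.integrable_left (hf : SmoothCptModZ p ω f) {m : GL (Fin 2) ℚ_[p]}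
    (hm : m 1 0 ≠ 0) {w : ℚ_[p] → ℂ} (hw : Continuous w) :
    Integrable (fun x ↦ f (uu p x * m) * w x) μ := by
  have hc := hf.hasCompactSupport_two_sided hm
  have hs : HasCompactSupport fun x ↦ f (uu p x * m) := by
    have := hc.comp_isClosedEmbedding (g := fun x : ℚ_[p] ↦ (x, (0 : ℚ_[p])))
      (Topology.IsClosedEmbedding.of_continuous_injective_isClosedMap (by fun_prop)
        (fun x y h ↦ congrArg Prod.fst h) (isClosedMap_prodMk_right 0))
    simpa [Function.comp_def, uu_zero] using this
  refine Continuous.integrable_of_hasCompactSupport ?_ hs.mul_right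
  exact (hf.1.continuous.comp ((continuous_uu p).mul continuous_const)).mul hw

/-- Averaging on the left does not change the Whittaker integral. -/
theorem SmoothCptModZ.Wf_leftAverage (hf : SmoothCptModZ p ω f) (hψ : Continuous ψ)
    (hψadd : ∀ x y, ψ (x + y) = ψ x * ψ y) (hψ0 : ∀ x, ψ x ≠ 0) {K : Set ℚ_[p]}
    (hK : IsCompact K) (hK0 : μ.real K ≠ 0) {m : GL (Fin 2) ℚ_[p]} (hm : m 1 0 ≠ 0) :
    Wf p μ ψ (leftAverage μ ψ K f) m = Wf p μ ψ f m := by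
  have h := integral_setIntegral_translate μ hK
    (hf.integrable_left (μ := μ) hm (w := fun x ↦ (ψ x)⁻¹) (hψ.inv₀ hψ0))
  have hK0' : (μ.real K : ℂ) ≠ 0 := by exact_mod_cast hK0
  calc Wf p μ ψ (leftAverage μ ψ K f) m
      = (μ.real K : ℂ)⁻¹ * ∫ x, ∫ t in K, f (uu p (x + t) * m) * (ψ (x + t))⁻¹ ∂μ ∂μ := by
        rw [Wf, ← integral_const_mul]
        refine integral_congr_ae (.of_forall fun x ↦ ?_)
        simp only [leftAverage, mul_assoc, ← integral_mul_const]
        congr 2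
        ext t
        rw [add_comm x t, uu_add, hψadd, mul_inv, mul_assoc]
    _ = _ := by rw [h, inv_mul_cancel_left₀ hK0', Wf]

theorem SmoothCptModZ.Wf_rightAverage (hf : SmoothCptModZ p ω f) (hψ : Continuous ψ)
    (hψ0 : ∀ x, ψ x ≠ 0) (K : Set ℚ_[p]) {m : GL (Fin 2) ℚ_[p]} (hm : m 1 0 ≠ 0) :
    Wf p μ ψ (rightAverage μ ψ K f) m =
      (μ.real K : ℂ)⁻¹ * ∫ t in K, Wf p μ ψ f (m * uu p t) * (ψ t)⁻¹ ∂μ := by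
  have hint : Integrable (fun q : ℚ_[p] × ℚ_[p] ↦ f (uu p q.1 * m * uu p q.2) *
      ((ψ q.2)⁻¹ * (ψ q.1)⁻¹)) (μ.prod (μ.restrict K)) := by
    refine (hf.integrable_two_sided (μ := μ) hm
      (w := fun q ↦ (ψ q.2)⁻¹ * (ψ q.1)⁻¹) ?_).mono_measure ?_
    · exact ((hψ.comp continuous_snd).inv₀ fun _ ↦ hψ0 _).mul
        ((hψ.comp continuous_fst).inv₀ fun _ ↦ hψ0 _)
    · exact Measure.prod_mono le_rfl Measure.restrict_le_self
  calc Wf p μ ψ (rightAverage μ ψ K f) m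
      = (μ.real K : ℂ)⁻¹ * ∫ x, ∫ t in K, f (uu p x * m * uu p t) *
          ((ψ t)⁻¹ * (ψ x)⁻¹) ∂μ ∂μ := by
        rw [Wf, ← integral_const_mul]
        refine integral_congr_ae (.of_forall fun x ↦ ?_)
        simp only [rightAverage, mul_assoc, ← integral_mul_const]
    _ = _ := by
        rw [integral_integral_swap hint]
        congr 2
        ext t
        rw [Wf, ← integral_mul_const]
        congr 1
        ext x
        rw [mul_assoc (uu p x)]
        ring

theorem SmoothCptModZ.integrable_Wf (hf : SmoothCptModZ p ω f) (hψ : Continuous ψ)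
    (hψ0 : ∀ x, ψ x ≠ 0) {m : GL (Fin 2) ℚ_[p]} (hm : m 1 0 ≠ 0) {φ : ℚ_[p] → ℂ}
    (hφ : Continuous φ) :
    Integrable (fun x ↦ Wf p μ ψ f (m * uu p x) * φ x * (ψ x)⁻¹) μ := by
  have := (hf.integrable_two_sided (μ := μ) hm
    (w := fun q ↦ (ψ q.1)⁻¹ * (φ q.2 * (ψ q.2)⁻¹))
    (((hψ.comp continuous_fst).inv₀ fun _ ↦ hψ0 _).mul ((hφ.comp continuous_snd).mul
      ((hψ.comp continuous_snd).inv₀ fun _ ↦ hψ0 _)))).integral_prod_right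
  refine this.congr (.of_forall fun x ↦ ?_)
  simp only [Wf, ← integral_mul_const]
  congr 1
  ext y
  rw [mul_assoc (uu p y)]
  ring

/-- Averaging on both sides does not change the integral of the Whittaker function against a
weight which is invariant under the averaging set. -/
theorem SmoothCptModZ.integral_Wf_average (hf : SmoothCptModZ p ω f) (hψ : Continuous ψ)
    (hψadd : ∀ x y, ψ (x + y) = ψ x * ψ y) (hψ0 : ∀ x, ψ x ≠ 0) {S T : Set ℚ_[p]}
    (hS : IsCompact S) (hS0 : μ.real S ≠ 0) (hT : IsCompact T) (hT0 : μ.real T ≠ 0)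
    {m : GL (Fin 2) ℚ_[p]} (hm : m 1 0 ≠ 0) {φ : ℚ_[p] → ℂ} (hφ : Continuous φ)
    (hφT : ∀ x, ∀ t ∈ T, φ (x + t) = φ x) :
    ∫ x, Wf p μ ψ (leftAverage μ ψ S (rightAverage μ ψ T f)) (m * uu p x) *
      φ x * (ψ x)⁻¹ ∂μ = ∫ x, Wf p μ ψ f (m * uu p x) * φ x * (ψ x)⁻¹ ∂μ := by
  have hT0' : (μ.real T : ℂ) ≠ 0 := by exact_mod_cast hT0
  have hm' : ∀ x, (m * uu p x) 1 0 ≠ 0 := fun x ↦ by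
    have : (m * uu p x) 1 0 = m 1 0 := by
      simp [Matrix.mul_apply, Fin.sum_univ_two, uu_val]
    rwa [this]
  have hav := integral_setIntegral_translate μ hT (hf.integrable_Wf (μ := μ) hψ hψ0 hm hφ)
  rw [← inv_mul_cancel_left₀ hT0' (∫ x, Wf p μ ψ f (m * uu p x) * φ x * (ψ x)⁻¹ ∂μ), ← hav,
    ← integral_const_mul]
  refine integral_congr_ae (.of_forall fun x ↦ ?_)
  simp only
  rw [(hf.average_right hT).Wf_leftAverage hψ hψadd hψ0 hS hS0 (hm' x),
    hf.Wf_rightAverage hψ hψ0 T (hm' x), mul_assoc, mul_assoc, ← integral_mul_const]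
  congr 1
  refine setIntegral_congr_fun hT.measurableSet fun t ht ↦ ?_
  simp only [hφT x t ht, uu_add, hψadd, mul_inv, mul_assoc]
  ring

/-- Averaging on both sides over subsets of a ball of radius `p ^ κ` does not change the partial
Bessel function. -/
theorem SmoothCptModZ.Jk_average (hf : SmoothCptModZ p ω f) (hψ : Continuous ψ)
    (hψadd : ∀ x y, ψ (x + y) = ψ x * ψ y) (hψ0 : ∀ x, ψ x ≠ 0) {S T : Set ℚ_[p]}
    (hS : IsCompact S) (hS0 : μ.real S ≠ 0) (hT : IsCompact T) (hT0 : μ.real T ≠ 0)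
    {κ : ℕ} (hκ : 2 ≤ κ) (hTκ : ∀ t ∈ T, ‖t‖ ≤ (p : ℝ) ^ κ)
    (n : ℚ_[p] × ℚ_[p] × ℚ_[p]) (h : Adm p n) :
    Jk p μ ψ κ n h (leftAverage μ ψ S (rightAverage μ ψ T f)) =
      Jk p μ ψ κ n h f :=
  hf.integral_Wf_average hψ hψadd hψ0 hS hS0 hT hT0 (m := mGL p n h) h.2.2.2.1
    (phiK_conj_isLocallyConstant hκ (nbarM p n)).continuous
    fun x t ht ↦ phiK_conj_add hκ _ x (hTκ t ht)

theorem setIntegral_closedBall_add (r : ℝ) {τ : ℚ_[p]} (hτ : ‖τ‖ ≤ r) (h : ℚ_[p] → ℂ) :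
    ∫ t in Metric.closedBall 0 r, h (t + τ) ∂μ = ∫ t in Metric.closedBall 0 r, h t ∂μ := by
  rw [← integral_indicator measurableSet_closedBall, ← integral_indicator measurableSet_closedBall,
    ← integral_add_right_eq_self (Set.indicator _ h) τ]
  congr 1
  ext t
  have : t + τ ∈ Metric.closedBall 0 r ↔ t ∈ Metric.closedBall 0 r := by
    simp only [mem_closedBall_zero_iff]
    refine ⟨fun h' ↦ ?_, fun h' ↦ (Padic.nonarchimedean _ _).trans (max_le h' hτ)⟩
    have := (Padic.nonarchimedean (t + τ) (-τ)).trans (max_le h' (by rwa [norm_neg]))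
    rwa [add_neg_cancel_right] at this
  by_cases ht : t ∈ Metric.closedBall 0 r
  · rw [Set.indicator_of_mem ht, Set.indicator_of_mem (this.2 ht)]
  · rw [Set.indicator_of_notMem ht, Set.indicator_of_notMem (mt this.1 ht)]

theorem setIntegral_closedBall_shift (hψadd : ∀ x y, ψ (x + y) = ψ x * ψ y)
    (hψ0 : ∀ x, ψ x ≠ 0) (r : ℝ) {τ : ℚ_[p]} (hτ : ‖τ‖ ≤ r) (h : ℚ_[p] → ℂ) :
    ∫ t in Metric.closedBall 0 r, h (t + τ) * (ψ t)⁻¹ ∂μ =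
      ψ τ * ∫ t in Metric.closedBall 0 r, h t * (ψ t)⁻¹ ∂μ := by
  rw [← setIntegral_closedBall_add r hτ fun t ↦ h t * (ψ t)⁻¹, ← integral_const_mul]
  congr 1
  ext t
  rw [hψadd]
  field_simp [hψ0 τ, hψ0 t]

theorem setIntegral_closedBall_char_eq_zero (hψadd : ∀ x y, ψ (x + y) = ψ x * ψ y) (r : ℝ)
    {e s : ℚ_[p]} (hs : ‖s‖ ≤ r) (hse : ψ (s * e) ≠ 1) :
    ∫ t in Metric.closedBall 0 r, ψ (t * e) ∂μ = 0 := by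
  have h := setIntegral_closedBall_add (μ := μ) r hs fun t ↦ ψ (t * e)
  simp only [add_mul, hψadd, integral_mul_const] at h
  have h' : (∫ t in Metric.closedBall 0 r, ψ (t * e) ∂μ) * (ψ (s * e) - 1) = 0 := by
    rw [mul_sub, h, mul_one, sub_self]
  exact (mul_eq_zero.1 h').resolve_right (sub_ne_zero.2 hse)

end Integrals

/-- `f` is invariant under `diag(1, d)` for `d` near `1`, uniformly on balls of `U`. -/
theorem SmoothCptModZ.exists_diagGL_invariant {ω : ℚ_[p]ˣ → ℂ} {f : GL (Fin 2) ℚ_[p] → ℂ}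
    (hf : SmoothCptModZ p ω f) (R : ℝ) :
    ∃ ε > 0, ∀ d : ℚ_[p]ˣ, ‖(d : ℚ_[p]) - 1‖ < ε → ∀ z, ‖z‖ ≤ R →
      f (diagGL p d * uu p z) = f (uu p z) := by
  have hc : IsLocallyConstant fun q : ℚ_[p]ˣ × ℚ_[p] ↦ f (diagGL p q.1 * uu p q.2) :=
    hf.1.comp_continuous (((continuous_diagGL p).comp continuous_fst).mul
      ((continuous_uu p).comp continuous_snd))
  have h1 : IsLocallyConstant fun q : ℚ_[p]ˣ × ℚ_[p] ↦ f (uu p q.2) :=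
    hf.1.comp_continuous ((continuous_uu p).comp continuous_snd)
  have key : ∀ᶠ d in nhds (1 : ℚ_[p]ˣ), ∀ z ∈ Metric.closedBall (0 : ℚ_[p]) R,
      f (diagGL p d * uu p z) = f (uu p z) := by
    refine (isCompact_closedBall (0 : ℚ_[p]) R).eventually_forall_of_forall_eventually
      fun z _ ↦ ?_
    filter_upwards [hc.eventually_eq (1, z), h1.eventually_eq (1, z)] with q hq hq'
    simp only [diagGL_one, one_mul] at hq
    rw [hq, hq']
  rw [Units.isEmbedding_val₀.nhds_eq_comap, Units.val_one,
    (Metric.nhds_basis_ball.comap _).eventually_iff] at key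
  obtain ⟨ε, hε, h⟩ := key
  refine ⟨ε, hε, fun d hd z hz ↦ h (by simpa [dist_eq_norm] using hd) z (by simpa using hz)⟩

/-- For `f` with `W^f(1) = 0`, suitable two-sided averages of `f` vanish on upper-triangular
matrices. -/
theorem SmoothCptModZ.exists_average_eq_zero [MeasurableSpace ℚ_[p]] [BorelSpace ℚ_[p]]
    {μ : Measure ℚ_[p]} [μ.IsAddHaarMeasure] {ψ : ℚ_[p] → ℂ}
    (hψadd : ∀ x y, ψ (x + y) = ψ x * ψ y) (hψ0 : ∀ x, ψ x ≠ 0) (hψnt : ∃ x, ψ x ≠ 1)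
    {ω : ℚ_[p]ˣ → ℂ} {f : GL (Fin 2) ℚ_[p] → ℂ} (hf : SmoothCptModZ p ω f)
    (hW : Wf p μ ψ f 1 = 0) :
    ∃ r > (0 : ℝ), ∃ R > (0 : ℝ), ∀ g : GL (Fin 2) ℚ_[p], g 1 0 = 0 →
      leftAverage μ ψ (Metric.closedBall 0 r) (rightAverage μ ψ (Metric.closedBall 0 R) f) g
        = 0 := by
  obtain ⟨B, hB1, hB⟩ := hf.exists_bound
  obtain ⟨ε, hε, hinv⟩ := hf.exists_diagGL_invariant B
  obtain ⟨x₀, hx₀⟩ := hψnt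
  obtain ⟨r, hr, hrx⟩ : ∃ r > (0 : ℝ), ‖x₀‖ < r * min ε 1 :=
    ⟨(‖x₀‖ + 1) / min ε 1, by positivity, by
      rw [div_mul_cancel₀ _ (by positivity)]; exact lt_add_one _⟩
  refine ⟨r, hr, max B (r * B), by positivity, fun g hg ↦ ?_⟩
  set R := max B (r * B)
  have hdet : g.val.det = g 0 0 * g 1 1 := by
    rw [Matrix.det_fin_two, hg, mul_zero, sub_zero]
  have hdet0 : g 0 0 * g 1 1 ≠ 0 := hdet ▸ Matrix.GeneralLinearGroup.det_ne_zero g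
  have ha : g 0 0 ≠ 0 := left_ne_zero_of_mul hdet0
  have hd : g 1 1 ≠ 0 := right_ne_zero_of_mul hdet0
  set d : ℚ_[p]ˣ := Units.mk0 (g 1 1 / g 0 0) (div_ne_zero hd ha)
  have hdv : (d : ℚ_[p]) = g 1 1 / g 0 0 := rfl
  have hcomm : ∀ s t, uu p s * g * uu p t = g * uu p (t + s * d) := by
    intro s t
    ext i j
    fin_cases i <;> fin_cases j <;>
      simp [Matrix.mul_apply, Fin.sum_univ_two, uu_val, Matrix.vecMul, dotProduct, hg, hdv]
    exact (by intro a b d s t ha; field_simp; ring :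
      ∀ a b d s t : ℚ_[p], a ≠ 0 → a * t + (b + s * d) = a * (t + s * (d / a)) + b) _ _ _ _ _ ha
  have hdecomp : ∀ t, g * uu p t =
      scalGL p (Units.mk0 _ ha) * (diagGL p d * uu p (t + g 0 1 / g 0 0)) := by
    intro t
    ext i j
    rw [scalGL_mul_apply]
    fin_cases i <;> fin_cases j <;>
      simp [Matrix.mul_apply, Fin.sum_univ_two, uu_val, diagGL_val, hg, hdv]
    · rw [mul_add]
      exact congrArg _ (mul_div_cancel₀ _ ha).symm
    · exact (mul_div_cancel₀ _ ha).symm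
  set y := g 0 1 / g 0 0
  set h : ℚ_[p] → ℂ := fun z ↦ f (diagGL p d * uu p z)
  have hright : ∀ s, rightAverage μ ψ (Metric.closedBall 0 R) f (uu p s * g) =
      (μ.real (Metric.closedBall 0 R) : ℂ)⁻¹ * (ω (Units.mk0 _ ha) *
        ∫ t in Metric.closedBall 0 R, h (t + s * d + y) * (ψ t)⁻¹ ∂μ) := by
    intro s
    rw [rightAverage, ← integral_const_mul (ω _)]
    refine congrArg _ (integral_congr_ae (.of_forall fun t ↦ ?_))
    simp only
    rw [hcomm, hdecomp, hf.2.1, mul_assoc]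
  have hsupp : ∀ z, h z ≠ 0 → ‖(d : ℚ_[p])‖ ≤ B ∧ ‖z‖ ^ 2 ≤ B * ‖(d : ℚ_[p])‖ := by
    intro z hz
    have h1 := hB _ hz
    have hdt : (diagGL p d * uu p z).val.det = d := by
      rw [Units.val_mul, Matrix.det_mul, uu_val, diagGL_val]
      simp
    rw [hdt] at h1
    have h11 := h1 1 1
    have h01 := h1 0 1
    simp only [Units.val_mul, uu_val, diagGL_val, Matrix.mul_apply, Fin.sum_univ_two] at h11 h01
    simp at h11 h01
    refine ⟨?_, h01⟩
    have : 0 < ‖(d : ℚ_[p])‖ := norm_pos_iff.2 d.ne_zero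
    nlinarith
  rw [leftAverage]
  refine mul_eq_zero_of_right _ ?_
  by_cases hdB : ‖(d : ℚ_[p])‖ ≤ B
  swap
  · have h0 : ∀ z, h z = 0 := fun z ↦ by
      by_contra hz
      exact hdB (hsupp z hz).1
    simp [hright, h0]
  have hshift : ∀ s ∈ Metric.closedBall (0 : ℚ_[p]) r,
      rightAverage μ ψ (Metric.closedBall 0 R) f (uu p s * g) * (ψ s)⁻¹ =
      ψ (s * (d - 1)) * ((μ.real (Metric.closedBall 0 R) : ℂ)⁻¹ * (ω (Units.mk0 _ ha) *
        ∫ t in Metric.closedBall 0 R, h (t + y) * (ψ t)⁻¹ ∂μ)) := by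
    intro s hs
    have hsd : ‖s * d‖ ≤ R := by
      rw [norm_mul]
      refine le_trans ?_ (le_max_right _ _)
      have := mem_closedBall_zero_iff.1 hs
      gcongr
    have hψs : ψ (s * d) = ψ (s * (d - 1)) * ψ s := by
      rw [← hψadd]
      congr 1
      ring
    rw [hright, setIntegral_closedBall_shift hψadd hψ0 R hsd fun t ↦ h (t + y), hψs]
    field_simp [hψ0 s]
  rw [setIntegral_congr_fun measurableSet_closedBall hshift, integral_mul_const]
  by_cases hs : ∃ s : ℚ_[p], ‖s‖ ≤ r ∧ ψ (s * (d - 1)) ≠ 1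
  · obtain ⟨s, hs, hse⟩ := hs
    rw [setIntegral_closedBall_char_eq_zero hψadd r hs hse, zero_mul]
  push Not at hs
  have hd1 : ‖(d : ℚ_[p]) - 1‖ < min ε 1 := by
    by_contra! hcon
    have hpos : 0 < ‖(d : ℚ_[p]) - 1‖ := lt_of_lt_of_le (by positivity) hcon
    have hne : (d : ℚ_[p]) - 1 ≠ 0 := norm_pos_iff.1 hpos
    refine hx₀ ?_
    have := hs (x₀ / (d - 1)) (by
      rw [norm_div, div_le_iff₀ hpos]
      exact hrx.le.trans (by gcongr))
    rwa [div_mul_cancel₀ _ hne] at this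
  have hnd : ‖(d : ℚ_[p])‖ ≤ 1 := by
    have := Padic.nonarchimedean ((d : ℚ_[p]) - 1) 1
    rw [sub_add_cancel, norm_one] at this
    exact this.trans (max_le (hd1.le.trans (min_le_right _ _)) le_rfl)
  have hhB : ∀ z, h z ≠ 0 → ‖z‖ ≤ B := fun z hz ↦ by
    have := (hsupp z hz).2
    nlinarith [norm_nonneg z]
  have hfB : ∀ z, f (uu p z) ≠ 0 → ‖z‖ ≤ B := fun z hz ↦ by
    have h01 := hB _ hz 0 1
    simp [uu_val] at h01
    nlinarith [norm_nonneg z]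
  have hhf : ∀ z, h z = f (uu p z) := by
    intro z
    by_cases hz : ‖z‖ ≤ B
    · exact hinv d (hd1.trans_le (min_le_left _ _)) z hz
    · rw [not_imp_comm.1 (hhB z) hz, not_imp_comm.1 (hfB z) hz]
  have hBR : B ≤ R := le_max_left _ _
  refine mul_eq_zero_of_right _ (mul_eq_zero_of_right _ (mul_eq_zero_of_right _ ?_))
  by_cases hy : ‖y‖ ≤ R
  · rw [setIntegral_closedBall_shift hψadd hψ0 R hy,
      setIntegral_eq_integral_of_forall_compl_eq_zero]
    · simp only [hhf]
      simp only [Wf, mul_one] at hW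
      rw [hW, mul_zero]
    · intro z hz
      rw [not_imp_comm.1 (hhB z) fun hz' ↦ hz (mem_closedBall_zero_iff.2 (hz'.trans hBR)),
        zero_mul]
  · refine setIntegral_eq_zero_of_forall_eq_zero fun t ht ↦ ?_
    rw [not_imp_comm.1 (hhB (t + y)) fun hz ↦ hy ?_, zero_mul]
    have := Padic.nonarchimedean (t + y) (-t)
    rw [add_neg_cancel_comm, norm_neg] at this
    exact this.trans (max_le (hz.trans hBR) (mem_closedBall_zero_iff.1 ht))

end BesselBigCell

noncomputable section

variable (p : ℕ) [Fact p.Prime] [MeasurableSpace ℚ_[p]]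

/-- Proposition 2.3.3: if `f ∈ C_c^∞(GL₂(k); ω)` satisfies `W^f(1) = 0`, then there are an
`f₀ ∈ C_c^∞(GL₂(k); ω)` supported inside the big cell — i.e. `f₀(g) = 0` for every
upper-triangular `g ∈ GL₂(k)` — and an integer `κ₀` such that `J_κ(n, f) = J_κ(n, f₀)`
for every admissible triple `n` and every `κ ≥ κ₀`. -/
theorem bessel_move_to_big_cell [BorelSpace ℚ_[p]]
    (μ : Measure ℚ_[p]) [μ.IsAddHaarMeasure]
    (ψ : ℚ_[p] → ℂ) (hψcont : Continuous ψ)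
    (hψadd : ∀ x y, ψ (x + y) = ψ x * ψ y)
    (hψnorm : ∀ x, ‖ψ x‖ = 1) (hψnt : ∃ x, ψ x ≠ 1)
    (ω : ℚ_[p]ˣ → ℂ) (hωmul : ∀ s t, ω (s * t) = ω s * ω t)
    (hωlc : IsLocallyConstant ω)
    (f : GL (Fin 2) ℚ_[p] → ℂ) (hf : SmoothCptModZ p ω f)
    (hW : Wf p μ ψ f 1 = 0) :
    ∃ f₀ : GL (Fin 2) ℚ_[p] → ℂ, SmoothCptModZ p ω f₀ ∧
      (∀ g : GL (Fin 2) ℚ_[p],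
        (g : Matrix (Fin 2) (Fin 2) ℚ_[p]) 1 0 = 0 → f₀ g = 0) ∧
      ∃ κ₀ : ℕ, ∀ κ : ℕ, κ₀ ≤ κ → ∀ n : ℚ_[p] × ℚ_[p] × ℚ_[p], ∀ h : Adm p n,
        Jk p μ ψ κ n h f = Jk p μ ψ κ n h f₀ := by
  have hψ0 : ∀ x, ψ x ≠ 0 := fun x hx ↦ by simpa [hx] using hψnorm x
  obtain ⟨r, hr, R, hR, hvan⟩ := hf.exists_average_eq_zero hψadd hψ0 hψnt hW
  have hvol : ∀ s : ℝ, 0 < s → μ.real (Metric.closedBall (0 : ℚ_[p]) s) ≠ 0 := fun s hs ↦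
    (ENNReal.toReal_pos (Metric.measure_closedBall_pos μ 0 hs).ne'
      (isCompact_closedBall _ _).measure_lt_top.ne).ne'
  have hc : ∀ s : ℝ, IsCompact (Metric.closedBall (0 : ℚ_[p]) s) := isCompact_closedBall 0
  obtain ⟨k, hk⟩ := pow_unbounded_of_one_lt R
    (by exact_mod_cast (Fact.out : p.Prime).one_lt : (1 : ℝ) < p)
  refine ⟨_, (hf.average_right (hc R)).average_left (hc r), hvan, max k 2, fun κ hκ n h ↦
    (hf.Jk_average hψcont hψadd hψ0 (hc r) (hvol r hr) (hc R) (hvol R hR)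
      ((le_max_right _ _).trans hκ) (fun t ht ↦ ?_) n h).symm⟩
  exact (mem_closedBall_zero_iff.1 ht).trans (hk.le.trans (pow_le_pow_right₀
    (by exact_mod_cast (Fact.out : p.Prime).one_lt.le) ((le_max_left _ _).trans hκ)))

end
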